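/- arXiv:1809.09496 — 4 statements merged into one kernel-verified Lean document; each statement's English description precedes it below -/
import Mathlib

section
/- For every φ : ℝ → ℝ smooth with compact support satisfying φ'(0) = 0, the identity ∫₀^∞ t^b (φ''(t) + b t^{-1} φ'(t))² dt = ∫₀^∞ t^b |φ''(t)|² dt + b ∫₀^∞ t^{b−2} |φ'(t)|² dt holds (all integrals being finite). -/
open MeasureTheory Set

/-- A power `t ^ b` with `b > -1` times a continuous compactly supported function is integrable
on `(0, ∞)`. -/
theorem integrableOn_Ioi_rpow_mul_of_hasCompactSupport {b : ℝ} (hb : -1 < b) {u : ℝ → ℝ}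
    (hu : Continuous u) (hc : HasCompactSupport u) :
    IntegrableOn (fun t : ℝ => t ^ b * u t) (Set.Ioi 0) := by
  obtain ⟨R, hR⟩ := hc.isCompact.isBounded.subset_closedBall 0
  have h : IntegrableOn (fun t : ℝ => t ^ b * u t) (Set.Ioc 0 (max R 0)) :=
    (intervalIntegrable_iff_integrableOn_Ioc_of_le (le_max_right R 0)).1
      ((intervalIntegral.intervalIntegrable_rpow' hb).mul_continuousOn hu.continuousOn)
  refine h.of_forall_sdiff_eq_zero measurableSet_Ioi fun t ht => ?_
  have hut : u t = 0 := by
    by_contra hne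
    have hmem := hR (subset_tsupport u hne)
    rw [mem_closedBall_zero_iff, Real.norm_eq_abs] at hmem
    exact ht.2 ⟨ht.1, ((le_abs_self t).trans hmem).trans (le_max_left R 0)⟩
  simp [hut]

/-- The divided difference at `a` of a compactly supported function vanishing at `a` is
compactly supported. -/
theorem HasCompactSupport.dslope_of_eq_zero {g : ℝ → ℝ} (hg : HasCompactSupport g) {a : ℝ}
    (ha : g a = 0) : HasCompactSupport (dslope g a) := by
  refine HasCompactSupport.intro (hg.isCompact.union isCompact_singleton) (K := tsupport g ∪ {a})
    fun t ht => ?_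
  rw [Set.mem_union, not_or] at ht
  rw [dslope_of_ne g ht.2, slope_def_field, image_eq_zero_of_notMem_tsupport ht.1, ha]
  simp

/-- The divided difference of a differentiable function is continuous. -/
theorem Differentiable.continuous_dslope {g : ℝ → ℝ} (hg : Differentiable ℝ g) (a : ℝ) :
    Continuous (dslope g a) := continuous_iff_continuousAt.2 fun t => by
  rcases eq_or_ne t a with rfl | ht
  · exact continuousAt_dslope_same.2 (hg _)
  · exact (continuousAt_dslope_of_ne ht).2 (hg t).continuousAt

/-- If `g` is differentiable with compact support and `g 0 = 0`, the derivative of `t ^ (b - 1) * g t ^ 2`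
has integral zero over `(0, ∞)`, for `b > -1`. -/
theorem integral_Ioi_deriv_rpow_mul_sq_eq_zero {b : ℝ} (hb : -1 < b) {g : ℝ → ℝ}
    (hg : Differentiable ℝ g) (hc : HasCompactSupport g) (h0 : g 0 = 0)
    (hint : IntegrableOn
      (fun t : ℝ => (b - 1) * (t ^ (b - 2) * g t ^ 2) + 2 * (t ^ (b - 1) * (g t * deriv g t)))
      (Set.Ioi 0)) :
    ∫ t in Set.Ioi (0 : ℝ),
      ((b - 1) * (t ^ (b - 2) * g t ^ 2) + 2 * (t ^ (b - 1) * (g t * deriv g t))) = 0 := by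
  have hcont : Continuous (dslope g 0) := hg.continuous_dslope 0
  have hF : ContinuousWithinAt (fun t : ℝ => t ^ (b + 1) * dslope g 0 t ^ 2) (Set.Ici 0) 0 :=
    ((Real.continuous_rpow_const (by linarith)).mul (hcont.pow 2)).continuousWithinAt
  have hderiv : ∀ t ∈ Set.Ioi (0 : ℝ), HasDerivAt (fun t : ℝ => t ^ (b + 1) * dslope g 0 t ^ 2)
      ((b - 1) * (t ^ (b - 2) * g t ^ 2) + 2 * (t ^ (b - 1) * (g t * deriv g t))) t := by
    intro t ht
    have h1 : HasDerivAt (fun t : ℝ => t ^ (b - 1) * g t ^ 2)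
        ((b - 1) * (t ^ (b - 2) * g t ^ 2) + 2 * (t ^ (b - 1) * (g t * deriv g t))) t := by
      refine ((Real.hasDerivAt_rpow_const (p := b - 1) (Or.inl (ne_of_gt ht))).fun_mul
        ((hg t).hasDerivAt.fun_pow 2)).congr_deriv ?_
      rw [show b - 1 - 1 = b - 2 by ring]
      push_cast
      ring
    refine h1.congr_of_eventuallyEq ?_
    filter_upwards [Ioi_mem_nhds ht] with s hs
    have hs' : (0 : ℝ) < s := hs
    rw [dslope_of_ne g hs'.ne', slope_def_field, h0, show b + 1 = b - 1 + 2 by ring,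
      Real.rpow_add hs', Real.rpow_two]
    simp only [sub_zero]
    field_simp
  have hlim : Filter.Tendsto (fun t : ℝ => t ^ (b + 1) * dslope g 0 t ^ 2) Filter.atTop
      (nhds 0) := by
    refine tendsto_const_nhds.congr' ?_
    have hz := hasCompactSupport_iff_eventuallyEq.1 (hc.dslope_of_eq_zero h0)
    rw [Filter.coclosedCompact_eq_cocompact] at hz
    filter_upwards [hz.filter_mono atTop_le_cocompact] with t ht
    simp [ht]
  rw [integral_Ioi_of_hasDerivAt_of_tendsto hF hderiv hint hlim]
  simp [Real.zero_rpow (by linarith : b + 1 ≠ 0)]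

/-- The weighted integral identity for `g' + b t⁻¹ g`, where `g` is `C¹` with compact support and
`g 0 = 0`. -/
theorem integral_Ioi_rpow_mul_deriv_add_sq {b : ℝ} (hb : -1 < b) {g : ℝ → ℝ}
    (hg : ContDiff ℝ 1 g) (hgc : HasCompactSupport g) (h0 : g 0 = 0) :
    IntegrableOn (fun t : ℝ => t ^ b * (deriv g t + b * t⁻¹ * g t) ^ 2)
        (Set.Ioi 0) ∧
    IntegrableOn (fun t : ℝ => t ^ b * deriv g t ^ 2) (Set.Ioi 0) ∧
    IntegrableOn (fun t : ℝ => t ^ (b - 2) * g t ^ 2) (Set.Ioi 0) ∧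
    ∫ t in Set.Ioi (0 : ℝ), t ^ b * (deriv g t + b * t⁻¹ * g t) ^ 2
      = (∫ t in Set.Ioi (0 : ℝ), t ^ b * deriv g t ^ 2)
        + b * ∫ t in Set.Ioi (0 : ℝ), t ^ (b - 2) * g t ^ 2 := by
  have hgd : Differentiable ℝ g := hg.differentiable one_ne_zero
  have hg' : Continuous (deriv g) := hg.continuous_deriv le_rfl
  have hcont : Continuous (dslope g 0) := hgd.continuous_dslope 0
  have hdc : HasCompactSupport (dslope g 0) := hgc.dslope_of_eq_zero h0
  have hds : ∀ t ∈ Set.Ioi (0 : ℝ), g t = t * dslope g 0 t := fun t ht => by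
    have := sub_smul_dslope g 0 t
    simpa [h0] using this.symm
  have I1 : IntegrableOn (fun t : ℝ => t ^ b * deriv g t ^ 2) (Set.Ioi 0) :=
    integrableOn_Ioi_rpow_mul_of_hasCompactSupport hb (hg'.pow 2)
      (hgc.deriv.comp_left (g := fun x : ℝ => x ^ 2) (by simp))
  have I2 : IntegrableOn (fun t : ℝ => t ^ (b - 2) * g t ^ 2) (Set.Ioi 0) := by
    have h : IntegrableOn (fun t : ℝ => t ^ b * dslope g 0 t ^ 2) (Set.Ioi 0) :=
      integrableOn_Ioi_rpow_mul_of_hasCompactSupport hb (hcont.pow 2)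
        (hdc.comp_left (g := fun x : ℝ => x ^ 2) (by simp))
    refine h.congr_fun (fun t ht => ?_) measurableSet_Ioi
    have ht' : (0 : ℝ) < t := ht
    simp only
    rw [hds t ht, Real.rpow_sub ht', Real.rpow_two]
    field_simp
  have I3 : IntegrableOn (fun t : ℝ => t ^ (b - 1) * (g t * deriv g t)) (Set.Ioi 0) := by
    have h : IntegrableOn (fun t : ℝ => t ^ b * (dslope g 0 t * deriv g t)) (Set.Ioi 0) :=
      integrableOn_Ioi_rpow_mul_of_hasCompactSupport hb (hcont.mul hg') hdc.mul_right
    refine h.congr_fun (fun t ht => ?_) measurableSet_Ioi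
    have ht' : (0 : ℝ) < t := ht
    simp only
    rw [hds t ht, Real.rpow_sub_one ht'.ne']
    field_simp
  have I4 : IntegrableOn (fun t : ℝ => (b - 1) * (t ^ (b - 2) * g t ^ 2)
      + 2 * (t ^ (b - 1) * (g t * deriv g t))) (Set.Ioi 0) :=
    (I2.const_mul (b - 1)).add (I3.const_mul 2)
  have hexp : Set.EqOn (fun t : ℝ => t ^ b * deriv g t ^ 2 + b * (t ^ (b - 2) * g t ^ 2)
      + b * ((b - 1) * (t ^ (b - 2) * g t ^ 2) + 2 * (t ^ (b - 1) * (g t * deriv g t))))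
      (fun t : ℝ => t ^ b * (deriv g t + b * t⁻¹ * g t) ^ 2) (Set.Ioi 0) := by
    intro t ht
    have ht' : (0 : ℝ) < t := ht
    simp only
    rw [Real.rpow_sub_one ht'.ne', Real.rpow_sub ht', Real.rpow_two]
    field_simp
    ring
  have I12 : IntegrableOn (fun t : ℝ => t ^ b * deriv g t ^ 2 + b * (t ^ (b - 2) * g t ^ 2))
      (Set.Ioi 0) := I1.add (I2.const_mul b)
  refine ⟨(I12.add (I4.const_mul b)).congr_fun hexp measurableSet_Ioi, I1, I2, ?_⟩
  rw [← setIntegral_congr_fun measurableSet_Ioi hexp, integral_add I12 (I4.const_mul b),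
    integral_add I1 (I2.const_mul b), integral_const_mul, integral_const_mul,
    integral_Ioi_deriv_rpow_mul_sq_eq_zero hb hgd hgc h0 I4, mul_zero, add_zero]

/-- For every smooth compactly supported `φ : ℝ → ℝ` with `φ'(0) = 0`, all three
weighted integrals are finite and
`∫₀^∞ t^b (φ'' + b t⁻¹ φ')² dt = ∫₀^∞ t^b |φ''|² dt + b ∫₀^∞ t^{b−2} |φ'|² dt`. -/
theorem stmt1 (b : ℝ) (hb1 : -1 < b) (hb2 : b < 1)
    (φ : ℝ → ℝ) (hφ : ContDiff ℝ (⊤ : ℕ∞) φ) (hsupp : HasCompactSupport φ)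
    (h0 : deriv φ 0 = 0) :
    IntegrableOn (fun t : ℝ => t ^ b * (deriv (deriv φ) t + b * t⁻¹ * deriv φ t) ^ 2)
        (Set.Ioi 0) ∧
    IntegrableOn (fun t : ℝ => t ^ b * (deriv (deriv φ) t) ^ 2) (Set.Ioi 0) ∧
    IntegrableOn (fun t : ℝ => t ^ (b - 2) * (deriv φ t) ^ 2) (Set.Ioi 0) ∧
    ∫ t in Set.Ioi (0 : ℝ), t ^ b * (deriv (deriv φ) t + b * t⁻¹ * deriv φ t) ^ 2
      = (∫ t in Set.Ioi (0 : ℝ), t ^ b * (deriv (deriv φ) t) ^ 2)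
        + b * ∫ t in Set.Ioi (0 : ℝ), t ^ (b - 2) * (deriv φ t) ^ 2 := by
  have h2 : ContDiff ℝ (1 + 1) φ := hφ.of_le (WithTop.coe_le_coe.2 le_top)
  exact integral_Ioi_rpow_mul_deriv_add_sq hb1 (contDiff_succ_iff_deriv.1 h2).2.2 hsupp.deriv h0
end

section
/- Assume moreover b ∈ (−1,0). Then for every φ : ℝ → ℝ smooth with compact support satisfying φ'(0) = 0 one has ∫₀^∞ t^b |φ''(t)|² dt + b ∫₀^∞ t^{b−2} |φ'(t)|² dt ≥ ((b+1)/(b−1))² ∫₀^∞ t^b |φ''(t)|² dt. -/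
open MeasureTheory Set

open Filter Topology

/-- A function on `(0,∞)` that is continuous, vanishes beyond `R` and is dominated by a multiple of
`t ^ b` with `-1 < b` is integrable. -/
theorem integrableOn_Ioi_of_le_rpow {b C R : ℝ} (hb : -1 < b) (hR : 0 ≤ R) {f : ℝ → ℝ}
    (hf : ContinuousOn f (Ioi 0)) (hle : ∀ t, 0 < t → |f t| ≤ C * t ^ b)
    (hz : ∀ t, R < t → f t = 0) : IntegrableOn f (Ioi 0) := by
  have h1 : IntegrableOn f (Ioc 0 R) := by
    have hg : IntegrableOn (fun t : ℝ => C * t ^ b) (Ioc 0 R) :=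
      ((intervalIntegrable_iff_integrableOn_Ioc_of_le hR).1
        (intervalIntegral.intervalIntegrable_rpow' hb)).const_mul C
    refine Integrable.mono' hg
      ((hf.mono fun x hx => hx.1).aestronglyMeasurable measurableSet_Ioc) ?_
    exact (ae_restrict_iff' measurableSet_Ioc).2 (ae_of_all _ fun t ht => hle t ht.1)
  have h2 : IntegrableOn f (Ioi R) :=
    integrableOn_zero.congr_fun (fun t ht => (hz t ht).symm) measurableSet_Ioi
  rw [← Ioc_union_Ioi_eq_Ioi hR]
  exact h1.union h2

/-- Hardy's inequality on the half-line with the weight `t ^ b`, `-1 < b`. -/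
theorem hardy_rpow_Ioi {b : ℝ} (hb : -1 < b) {ψ : ℝ → ℝ} (hψ : ContDiff ℝ 1 ψ)
    (hsupp : HasCompactSupport ψ) (h0 : ψ 0 = 0) :
    ((1 - b) / 2) ^ 2 * ∫ t in Ioi (0 : ℝ), t ^ (b - 2) * ψ t ^ 2
      ≤ ∫ t in Ioi (0 : ℝ), t ^ b * deriv ψ t ^ 2 := by
  have hd : Differentiable ℝ ψ := hψ.differentiable one_ne_zero
  have hc' : Continuous (deriv ψ) := hψ.continuous_deriv le_rfl
  obtain ⟨C, hC⟩ := hsupp.deriv.exists_bound_of_continuous hc'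
  have hC0 : 0 ≤ C := (norm_nonneg _).trans (hC 0)
  have hlip : ∀ t, 0 < t → |ψ t| ≤ C * t := fun t ht => by
    have := convex_univ.norm_image_sub_le_of_norm_deriv_le (f := ψ) (C := C)
      (fun x _ => hd x) (fun x _ => hC x) (mem_univ 0) (mem_univ t)
    simpa [h0, abs_of_pos ht] using this
  obtain ⟨R, hR0, hR⟩ : ∃ R, 0 ≤ R ∧ ∀ t, R < t → ψ t = 0 ∧ deriv ψ t = 0 := by
    obtain ⟨R, hR⟩ := (hsupp.isCompact.isBounded.subset_closedBall 0)
    refine ⟨max R 0, le_max_right _ _, fun t ht => ?_⟩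
    have hnot : t ∉ tsupport ψ := fun h => by
      have := hR h
      rw [Metric.mem_closedBall, dist_zero_right, Real.norm_eq_abs] at this
      exact absurd ((le_abs_self t).trans this) (not_le.2 ((le_max_left _ _).trans_lt ht))
    exact ⟨image_eq_zero_of_notMem_tsupport hnot,
      image_eq_zero_of_notMem_tsupport fun h => hnot (tsupport_deriv_subset h)⟩
  have hpow : ∀ c : ℝ, ContinuousOn (fun t : ℝ => t ^ c) (Ioi 0) := fun c t ht =>
    (Real.continuousAt_rpow_const t c (Or.inl (ne_of_gt ht))).continuousWithinAt
  have e1 : ∀ t : ℝ, 0 < t → t ^ (b - 1) * t = t ^ b := fun t ht => by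
    rw [← Real.rpow_add_one ht.ne']; ring_nf
  have e2 : ∀ t : ℝ, 0 < t → t ^ (b - 2) * t = t ^ (b - 1) := fun t ht => by
    rw [← Real.rpow_add_one ht.ne']; ring_nf
  have i1 : IntegrableOn (fun t => t ^ b * deriv ψ t ^ 2) (Ioi 0) := by
    refine integrableOn_Ioi_of_le_rpow (C := C ^ 2) hb hR0
      ((hpow b).mul (hc'.pow 2).continuousOn) (fun t ht => ?_) fun t ht => by simp [(hR t ht).2]
    have hp := Real.rpow_nonneg ht.le b
    rw [abs_mul, abs_of_nonneg hp, abs_pow, mul_comm]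
    gcongr
    exact hC t
  have i2 : IntegrableOn (fun t => t ^ (b - 2) * ψ t ^ 2) (Ioi 0) := by
    refine integrableOn_Ioi_of_le_rpow (C := C ^ 2) hb hR0
      ((hpow _).mul (hd.continuous.pow 2).continuousOn) (fun t ht => ?_)
      fun t ht => by simp [(hR t ht).1]
    have hp := Real.rpow_nonneg ht.le (b - 2)
    rw [abs_mul, abs_of_nonneg hp, abs_pow, ← e1 t ht, ← e2 t ht]
    calc t ^ (b - 2) * |ψ t| ^ 2 ≤ t ^ (b - 2) * (C * t) ^ 2 := by gcongr; exact hlip t ht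
      _ = _ := by ring
  have i3 : IntegrableOn (fun t => t ^ (b - 1) * (ψ t * deriv ψ t)) (Ioi 0) := by
    refine integrableOn_Ioi_of_le_rpow (C := C ^ 2) hb hR0
      ((hpow _).mul (hd.continuous.mul hc').continuousOn) (fun t ht => ?_)
      fun t ht => by simp [(hR t ht).1]
    have hp := Real.rpow_nonneg ht.le (b - 1)
    rw [abs_mul, abs_of_nonneg hp, abs_mul, ← e1 t ht]
    calc t ^ (b - 1) * (|ψ t| * |deriv ψ t|) ≤ t ^ (b - 1) * ((C * t) * C) := by
          gcongr
          · exact hlip t ht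
          · exact hC t
      _ = _ := by ring
  have i4 : IntegrableOn (fun t : ℝ =>
      (b - 1) * (t ^ (b - 2) * ψ t ^ 2) + 2 * (t ^ (b - 1) * (ψ t * deriv ψ t))) (Ioi 0) :=
    (i2.const_mul _).add (i3.const_mul _)
  have hG : ∫ t in Ioi (0 : ℝ),
      ((b - 1) * (t ^ (b - 2) * ψ t ^ 2) + 2 * (t ^ (b - 1) * (ψ t * deriv ψ t))) = 0 := by
    have hcont : ContinuousWithinAt (fun t : ℝ => t ^ (b - 1) * ψ t ^ 2) (Ici 0) 0 := by
      rw [← continuousWithinAt_Ioi_iff_Ici, ContinuousWithinAt, h0]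
      have hlim : Tendsto (fun t : ℝ => C ^ 2 * t ^ (b + 1)) (𝓝[>] 0) (𝓝 0) := by
        have := ((Real.continuousAt_rpow_const 0 (b + 1)
          (Or.inr (by linarith))).tendsto.const_mul (C ^ 2)).mono_left
          (nhdsWithin_le_nhds (s := Ioi 0))
        simpa [Real.zero_rpow (by linarith : b + 1 ≠ 0)] using this
      rw [zero_pow two_ne_zero, mul_zero]
      refine tendsto_of_tendsto_of_tendsto_of_le_of_le' tendsto_const_nhds hlim ?_ ?_ <;>
        filter_upwards [self_mem_nhdsWithin] with t ht
      · exact mul_nonneg (Real.rpow_nonneg (le_of_lt ht) _) (sq_nonneg _)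
      · have ht' : 0 < t := ht
        have hp := Real.rpow_nonneg ht'.le (b - 1)
        rw [Real.rpow_add_one ht'.ne', ← e1 t ht', ← sq_abs (ψ t)]
        calc t ^ (b - 1) * |ψ t| ^ 2 ≤ t ^ (b - 1) * (C * t) ^ 2 := by gcongr; exact hlip t ht'
          _ = _ := by ring
    have := integral_Ioi_of_hasDerivAt_of_tendsto (m := 0) hcont (f' := fun t =>
        (b - 1) * (t ^ (b - 2) * ψ t ^ 2) + 2 * (t ^ (b - 1) * (ψ t * deriv ψ t))) ?_
      i4 ?_
    · simpa [h0] using this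
    · intro t ht
      have h := (Real.hasDerivAt_rpow_const (p := b - 1) (Or.inl (ne_of_gt ht))).mul
        ((hd t).hasDerivAt.pow 2)
      refine h.congr_deriv ?_
      rw [show b - 1 - 1 = b - 2 by ring]
      simp only [Pi.pow_apply]
      push_cast
      ring
    · refine tendsto_const_nhds.congr' ?_
      filter_upwards [eventually_gt_atTop R] with t ht
      simp [(hR t ht).1]
  have hmono : ∫ t in Ioi (0 : ℝ), (((1 - b) / 2) ^ 2 * (t ^ (b - 2) * ψ t ^ 2)
      + (1 - b) / 2 *
        ((b - 1) * (t ^ (b - 2) * ψ t ^ 2) + 2 * (t ^ (b - 1) * (ψ t * deriv ψ t))))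
      ≤ ∫ t in Ioi (0 : ℝ), t ^ b * deriv ψ t ^ 2 := by
    refine setIntegral_mono_on
      ((i2.const_mul _).add (i4.const_mul _))
      i1 measurableSet_Ioi fun t ht => ?_
    have ht' : 0 < t := ht
    have hp := Real.rpow_nonneg ht'.le (b - 2)
    have := mul_nonneg hp (sq_nonneg (t * deriv ψ t - (1 - b) / 2 * ψ t))
    rw [← e1 t ht', ← e2 t ht']
    linarith
  rw [integral_add (i2.const_mul _) (i4.const_mul _),
    integral_const_mul, integral_const_mul, hG, mul_zero, add_zero] at hmono
  exact hmono

/-- For `b ∈ (−1,0)` and every smooth compactly supported `φ : ℝ → ℝ` with `φ'(0) = 0`,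
`∫₀^∞ t^b |φ''|² dt + b ∫₀^∞ t^{b−2} |φ'|² dt ≥ ((b+1)/(b−1))² ∫₀^∞ t^b |φ''|² dt`. -/
theorem stmt3 (b : ℝ) (hb1 : -1 < b) (hb2 : b < 0)
    (φ : ℝ → ℝ) (hφ : ContDiff ℝ (⊤ : ℕ∞) φ) (hsupp : HasCompactSupport φ)
    (h0 : deriv φ 0 = 0) :
    (∫ t in Set.Ioi (0 : ℝ), t ^ b * (deriv (deriv φ) t) ^ 2)
        + b * ∫ t in Set.Ioi (0 : ℝ), t ^ (b - 2) * (deriv φ t) ^ 2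
      ≥ ((b + 1) / (b - 1)) ^ 2 * ∫ t in Set.Ioi (0 : ℝ), t ^ b * (deriv (deriv φ) t) ^ 2 := by
  have hψ : ContDiff ℝ 1 (deriv φ) :=
    ((contDiff_infty_iff_deriv.1 hφ).2).of_le (by exact_mod_cast le_top)
  have key := hardy_rpow_Ioi hb1 hψ hsupp.deriv h0
  set A := ∫ t in Set.Ioi (0 : ℝ), t ^ b * (deriv (deriv φ) t) ^ 2
  set B := ∫ t in Set.Ioi (0 : ℝ), t ^ (b - 2) * (deriv φ t) ^ 2
  have hne : b - 1 ≠ 0 := by linarith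
  have hB : B ≤ 4 / (b - 1) ^ 2 * A := by
    rw [div_mul_eq_mul_div, le_div_iff₀ (by positivity)]
    linarith
  calc ((b + 1) / (b - 1)) ^ 2 * A = A + b * (4 / (b - 1) ^ 2 * A) := by field_simp; ring
    _ ≤ A + b * B := by linarith [mul_le_mul_of_nonpos_left hB hb2.le]
end

section
/- There exists a function φ : [0,∞) → ℝ which is twice continuously differentiable on [0,∞), infinitely differentiable on (0,∞), satisfies φ(0) = 1 and φ'(0) = 0, solves the fourth-order equation Δ_{b,t}(Δ_{b,t}φ)(t) − 2 Δ_{b,t}φ(t) + φ(t) = 0 for all t > 0, and satisfies ∫₀^∞ t^b [ (Δ_{b,t}φ(t) − φ(t))² + |φ'(t)|² + |φ(t)|² ] dt < ∞. -/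
open MeasureTheory Set

noncomputable section

/-- The one-dimensional Bessel-type operator `Δ_{b,t} ψ (t) = ψ''(t) + (b/t) ψ'(t)`. -/
def Dbt (b : ℝ) (ψ : ℝ → ℝ) : ℝ → ℝ := fun t => deriv (deriv ψ) t + (b / t) * deriv ψ t

open Filter Topology

/-- The integral `∫₀^∞ s^(a-1) exp(-s - t²/(4s)) ds`, which for `t > 0` is a multiple of
`t ^ a * K_a(t)`, where `K_a` is the modified Bessel function of the second kind. -/
def besselInt (a t : ℝ) : ℝ :=
  ∫ s in Ioi (0 : ℝ), s ^ (a - 1) * Real.exp (-s - t ^ 2 / 4 / s)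

theorem aestronglyMeasurable_rpow_mul_exp (p c : ℝ) :
    AEStronglyMeasurable (fun s : ℝ => s ^ p * Real.exp (-s - c / s))
      (volume.restrict (Ioi 0)) := by
  apply Measurable.aestronglyMeasurable
  fun_prop

theorem integrableOn_rpow_mul_exp_neg {p : ℝ} (hp : -1 < p) :
    IntegrableOn (fun s : ℝ => s ^ p * Real.exp (-s)) (Ioi 0) := by
  simpa using integrableOn_rpow_mul_exp_neg_mul_rpow hp one_pos one_pos

theorem integrableOn_rpow_mul_exp_of_nonneg {p c : ℝ} (hp : -1 < p) (hc : 0 ≤ c) :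
    IntegrableOn (fun s : ℝ => s ^ p * Real.exp (-s - c / s)) (Ioi 0) := by
  refine (integrableOn_rpow_mul_exp_neg hp).mono' (aestronglyMeasurable_rpow_mul_exp p c) ?_
  filter_upwards [ae_restrict_mem measurableSet_Ioi] with s (hs : 0 < s)
  rw [Real.norm_of_nonneg (by positivity)]
  gcongr
  have : 0 ≤ c / s := by positivity
  linarith

theorem integrableOn_rpow_mul_exp_of_pos (p : ℝ) {c : ℝ} (hc : 0 < c) :
    IntegrableOn (fun s : ℝ => s ^ p * Real.exp (-s - c / s)) (Ioi 0) := by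
  obtain ⟨n, hn⟩ := exists_nat_gt (-1 - p)
  refine ((integrableOn_rpow_mul_exp_neg (p := p + n) (by linarith)).const_mul
    (n.factorial / c ^ n)).mono' (aestronglyMeasurable_rpow_mul_exp p c) ?_
  filter_upwards [ae_restrict_mem measurableSet_Ioi] with s (hs : 0 < s)
  rw [Real.norm_of_nonneg (by positivity), Real.rpow_add hs, Real.rpow_natCast, sub_eq_add_neg,
    Real.exp_add, Real.exp_neg (c / s)]
  have h : (Real.exp (c / s))⁻¹ ≤ n.factorial / c ^ n * s ^ n := by
    have h1 := Real.pow_div_factorial_le_exp (c / s) (by positivity) n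
    refine (inv_anti₀ (by positivity) h1).trans_eq ?_
    rw [div_pow]
    field_simp
  calc s ^ p * (Real.exp (-s) * (Real.exp (c / s))⁻¹)
      ≤ s ^ p * (Real.exp (-s) * (n.factorial / c ^ n * s ^ n)) := by gcongr
    _ = _ := by ring

theorem hasDerivAt_besselInt (a : ℝ) {t : ℝ} (ht : t ≠ 0) :
    HasDerivAt (besselInt a) (-(t / 2) * besselInt (a - 1) t) t := by
  have ht0 : 0 < |t| := abs_pos.mpr ht
  have ht2 : 0 < t ^ 2 := by positivity
  have key := hasDerivAt_integral_of_dominated_loc_of_deriv_le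
    (μ := volume.restrict (Ioi (0 : ℝ)))
    (F := fun t s : ℝ => s ^ (a - 1) * Real.exp (-s - t ^ 2 / 4 / s))
    (F' := fun t s : ℝ => -(t / 2) * (s ^ (a - 1 - 1) * Real.exp (-s - t ^ 2 / 4 / s)))
    (bound := fun s : ℝ => |t| * (s ^ (a - 1 - 1) * Real.exp (-s - t ^ 2 / 16 / s)))
    (Metric.ball_mem_nhds t (half_pos ht0))
    (Filter.Eventually.of_forall fun x => aestronglyMeasurable_rpow_mul_exp (a - 1) (x ^ 2 / 4))
    (integrableOn_rpow_mul_exp_of_pos (a - 1) (by positivity))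
    ((aestronglyMeasurable_rpow_mul_exp (a - 1 - 1) (t ^ 2 / 4)).const_mul _)
    ?_ ((integrableOn_rpow_mul_exp_of_pos (a - 1 - 1) (by positivity)).const_mul _) ?_
  · have h := key.2
    rw [integral_const_mul] at h
    exact h
  · filter_upwards [ae_restrict_mem measurableSet_Ioi] with s (hs : 0 < s) x hx
    rw [Metric.mem_ball, Real.dist_eq] at hx
    have h1 : |x| ≤ 2 * |t| := by
      have := abs_sub_abs_le_abs_sub x t
      linarith
    have h2 : |t| / 2 ≤ |x| := by
      have := abs_sub_abs_le_abs_sub t x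
      rw [abs_sub_comm] at this
      linarith
    have h3 : t ^ 2 / 16 ≤ x ^ 2 / 4 := by
      have := pow_le_pow_left₀ (by positivity) h2 2
      rw [div_pow, sq_abs, sq_abs] at this
      linarith
    rw [norm_mul, Real.norm_of_nonneg (r := s ^ _ * _) (by positivity), norm_neg, Real.norm_eq_abs,
      abs_div, abs_two]
    gcongr
    linarith
  · filter_upwards [ae_restrict_mem measurableSet_Ioi] with s (hs : 0 < s) x _
    have h : HasDerivAt (fun x : ℝ => -s - x ^ 2 / 4 / s) (-(x / 2 / s)) x := by
      convert! (((hasDerivAt_pow 2 x).div_const 4).div_const s).const_sub (-s) using 1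
      field_simp
      norm_num
      ring
    convert! (h.exp.const_mul (s ^ (a - 1))) using 1
    rw [Real.rpow_sub_one hs.ne' (a - 1)]
    ring

theorem contDiffOn_besselInt (n : ℕ) (a : ℝ) : ContDiffOn ℝ n (besselInt a) (Ioi 0) := by
  induction n generalizing a with
  | zero =>
    rw [Nat.cast_zero, contDiffOn_zero]
    exact fun t ht => (hasDerivAt_besselInt a (ne_of_gt ht)).continuousAt.continuousWithinAt
  | succ n ih =>
    rw [Nat.cast_succ, contDiffOn_succ_iff_deriv_of_isOpen isOpen_Ioi]
    refine ⟨fun t ht => (hasDerivAt_besselInt a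
      (ne_of_gt ht)).differentiableAt.differentiableWithinAt, by simp, ?_⟩
    have h : ContDiffOn ℝ n (fun t => -(t / 2) * besselInt (a - 1) t) (Ioi 0) :=
      ContDiffOn.mul (by fun_prop) (ih (a - 1))
    exact h.congr fun t ht => (hasDerivAt_besselInt a (ne_of_gt ht)).deriv

theorem besselInt_recurrence (a : ℝ) {t : ℝ} (ht : t ≠ 0) :
    t ^ 2 / 4 * besselInt (a - 1) t = besselInt (a + 1) t - a * besselInt a t := by
  set c := t ^ 2 / 4 with hc
  have hc0 : 0 < c := by positivity
  have hint (p : ℝ) := integrableOn_rpow_mul_exp_of_pos p hc0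
  have h1 : ∀ s ∈ Ioi (0 : ℝ), HasDerivAt (fun s : ℝ => s ^ a) (a * s ^ (a - 1)) s :=
    fun s hs => Real.hasDerivAt_rpow_const (Or.inl (ne_of_gt hs))
  have h2 : ∀ s ∈ Ioi (0 : ℝ), HasDerivAt (fun s : ℝ => Real.exp (-s - c / s))
      (Real.exp (-s - c / s) * (-1 + c / s ^ 2)) s := by
    intro s (hs : 0 < s)
    apply HasDerivAt.exp
    convert! (hasDerivAt_id s).neg.sub ((hasDerivAt_const s c).div (hasDerivAt_id s) hs.ne')
      using 1
    simp
    ring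
  have hI := (((hint (a - 1)).const_mul a).sub (hint a)).add ((hint (a - 1 - 1)).const_mul c)
  have hE : EqOn (fun s : ℝ => a * (s ^ (a - 1) * Real.exp (-s - c / s))
        - s ^ a * Real.exp (-s - c / s) + c * (s ^ (a - 1 - 1) * Real.exp (-s - c / s)))
      (fun s => a * s ^ (a - 1) * Real.exp (-s - c / s)
        + s ^ a * (Real.exp (-s - c / s) * (-1 + c / s ^ 2))) (Ioi 0) := by
    intro s (hs : 0 < s)
    simp only
    rw [Real.rpow_sub_one hs.ne' (a - 1), Real.rpow_sub_one hs.ne' a]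
    field_simp
    ring
  have htop : Tendsto (fun s : ℝ => s ^ a * Real.exp (-s - c / s)) atTop (𝓝 0) := by
    have h := tendsto_rpow_mul_exp_neg_mul_atTop_nhds_zero a 1 one_pos
    refine tendsto_of_tendsto_of_tendsto_of_le_of_le' tendsto_const_nhds h ?_ ?_
    · filter_upwards [eventually_gt_atTop 0] with s hs
      positivity
    · filter_upwards [eventually_gt_atTop 0] with s hs
      have : 0 ≤ c / s := by positivity
      gcongr
      linarith
  have hzero : Tendsto (fun s : ℝ => s ^ a * Real.exp (-s - c / s)) (𝓝[>] 0) (𝓝 0) := by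
    have h := (tendsto_rpow_mul_exp_neg_mul_atTop_nhds_zero (-a) c hc0).comp
      tendsto_inv_nhdsGT_zero
    refine tendsto_of_tendsto_of_tendsto_of_le_of_le' tendsto_const_nhds h ?_ ?_
    · filter_upwards [self_mem_nhdsWithin] with s (hs : 0 < s)
      positivity
    · filter_upwards [self_mem_nhdsWithin] with s (hs : 0 < s)
      rw [Function.comp_apply, Real.inv_rpow hs.le, Real.rpow_neg hs.le, inv_inv]
      gcongr
      rw [neg_mul, ← div_eq_mul_inv]
      linarith
  have h := integral_Ioi_deriv_mul_eq_sub h1 h2 (IntegrableOn.congr_fun hI hE measurableSet_Ioi)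
    hzero htop
  have hadd := integral_add (((hint (a - 1)).const_mul a).sub (hint a))
    ((hint (a - 1 - 1)).const_mul c)
  simp only [Pi.sub_apply] at hadd
  rw [← setIntegral_congr_fun measurableSet_Ioi hE, hadd, integral_sub ((hint (a - 1)).const_mul a) (hint a), integral_const_mul, integral_const_mul] at h
  simp only [besselInt, ← hc, add_sub_cancel_right]
  linarith

theorem continuous_besselInt {a : ℝ} (ha : 0 < a) : Continuous (besselInt a) := by
  refine continuous_of_dominated
    (fun t => aestronglyMeasurable_rpow_mul_exp (a - 1) (t ^ 2 / 4)) (fun t => ?_)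
    (integrableOn_rpow_mul_exp_neg (p := a - 1) (by linarith)) ?_
  · filter_upwards [ae_restrict_mem measurableSet_Ioi] with s (hs : 0 < s)
    rw [Real.norm_of_nonneg (by positivity)]
    have : 0 ≤ t ^ 2 / 4 / s := by positivity
    gcongr
    linarith
  · exact Filter.Eventually.of_forall fun s => by fun_prop

theorem besselInt_zero {a : ℝ} (ha : 0 < a) : besselInt a 0 = Real.Gamma a := by
  simp [besselInt, Real.Gamma_eq_integral ha, mul_comm]

theorem besselInt_nonneg (a t : ℝ) : 0 ≤ besselInt a t :=
  setIntegral_nonneg measurableSet_Ioi fun s (hs : 0 < s) => by positivity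

theorem besselInt_le {a : ℝ} (ha : 0 < a) (t : ℝ) :
    besselInt a t ≤ Real.exp (-(t / 2)) *
      ∫ s in Ioi (0 : ℝ), s ^ (a - 1) * Real.exp (-(1 / 2) * s) := by
  have hint : IntegrableOn (fun s : ℝ => s ^ (a - 1) * Real.exp (-(1 / 2) * s)) (Ioi 0) := by
    simpa using integrableOn_rpow_mul_exp_neg_mul_rpow (s := a - 1) (by linarith) one_pos
      (one_half_pos (α := ℝ))
  rw [← integral_const_mul]
  refine setIntegral_mono_on (integrableOn_rpow_mul_exp_of_nonneg (by linarith) (by positivity))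
    (hint.const_mul _) measurableSet_Ioi fun s (hs : 0 < s) => ?_
  rw [mul_left_comm, ← Real.exp_add]
  gcongr
  have h : 0 ≤ (t - s) ^ 2 / (4 * s) := by positivity
  have h2 : (t - s) ^ 2 / (4 * s) = t ^ 2 / 4 / s - t / 2 + s / 4 := by
    field_simp
    ring
  linarith

theorem integrableOn_rpow_mul_besselInt_sq {a p : ℝ} (ha : 0 < a) (hp : -1 < p) :
    IntegrableOn (fun t : ℝ => t ^ p * besselInt a t ^ 2) (Ioi 0) := by
  set C := ∫ s in Ioi (0 : ℝ), s ^ (a - 1) * Real.exp (-(1 / 2) * s)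
  refine ((integrableOn_rpow_mul_exp_neg hp).const_mul (C ^ 2)).mono' ?_ ?_
  · have := (continuous_besselInt ha).measurable
    exact Measurable.aestronglyMeasurable (by fun_prop)
  · filter_upwards [ae_restrict_mem measurableSet_Ioi] with t (ht : 0 < t)
    rw [Real.norm_of_nonneg (by positivity)]
    calc t ^ p * besselInt a t ^ 2 ≤ t ^ p * (Real.exp (-(t / 2)) * C) ^ 2 := by
          gcongr
          · exact besselInt_nonneg a t
          · exact besselInt_le ha t
      _ = _ := by
          rw [mul_pow, ← Real.exp_nat_mul]
          push_cast
          ring_nf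

theorem hasDerivAt_besselInt_of_one_lt {a : ℝ} (ha : 1 < a) (t : ℝ) :
    HasDerivAt (besselInt a) (-(t / 2) * besselInt (a - 1) t) t := by
  have h1 := continuous_besselInt (a := a) (by linarith)
  have h2 := continuous_besselInt (a := a - 1) (by linarith)
  exact hasDerivAt_of_hasDerivAt_of_ne' (x := 0)
    (g := fun t => -(t / 2) * besselInt (a - 1) t) (fun t ht => hasDerivAt_besselInt a ht)
    h1.continuousAt (Continuous.continuousAt (by fun_prop)) t

theorem hasDerivAt_neg_half_mul_besselInt (a : ℝ) {t : ℝ} (ht : t ≠ 0) :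
    HasDerivAt (fun t => -(t / 2) * besselInt a t)
      (besselInt (a + 1) t - (a + 1 / 2) * besselInt a t) t := by
  convert! (((hasDerivAt_id t).div_const 2).neg).mul (hasDerivAt_besselInt a ht) using 1
  have h := besselInt_recurrence a ht
  simp only [id, Pi.neg_apply]
  linear_combination -h

theorem contDiff_two_besselInt {a : ℝ} (ha : 1 < a) : ContDiff ℝ 2 (besselInt a) := by
  have h1 := continuous_besselInt (a := a) (by linarith)
  have h2 := continuous_besselInt (a := a - 1) (by linarith)
  have hd : deriv (besselInt a) = fun t => -(t / 2) * besselInt (a - 1) t :=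
    funext fun t => (hasDerivAt_besselInt_of_one_lt ha t).deriv
  have hd2 : ∀ t, HasDerivAt (fun t => -(t / 2) * besselInt (a - 1) t)
      (besselInt a t - (a - 1 / 2) * besselInt (a - 1) t) t := by
    refine hasDerivAt_of_hasDerivAt_of_ne' (x := 0)
      (g := fun t => besselInt a t - (a - 1 / 2) * besselInt (a - 1) t) (fun t ht => ?_)
      (Continuous.continuousAt (by fun_prop)) (Continuous.continuousAt (by fun_prop))
    convert! hasDerivAt_neg_half_mul_besselInt (a - 1) ht using 1
    ring_nf
  rw [show (2 : WithTop ℕ∞) = 1 + 1 by norm_num, contDiff_succ_iff_deriv]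
  refine ⟨fun t => (hasDerivAt_besselInt_of_one_lt ha t).differentiableAt, by simp, ?_⟩
  rw [hd, contDiff_one_iff_deriv]
  refine ⟨fun t => (hd2 t).differentiableAt, ?_⟩
  rw [funext fun t => (hd2 t).deriv]
  fun_prop

theorem Dbt_congr (b : ℝ) {f g : ℝ → ℝ} (h : EqOn f g (Ioi 0)) :
    EqOn (Dbt b f) (Dbt b g) (Ioi 0) := by
  intro t ht
  have hfg : f =ᶠ[𝓝 t] g := h.eventuallyEq_of_mem (Ioi_mem_nhds ht)
  simp only [Dbt, hfg.deriv_eq, hfg.deriv.deriv_eq]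

/-- On the span of `besselInt (a + 1)` and `besselInt a` with `a = (1 - b) / 2`, the operator
`Dbt b` acts as a Jordan block with eigenvalue `1`. -/
theorem Dbt_besselInt (b p q : ℝ) {t : ℝ} (ht : 0 < t) :
    Dbt b (fun t => p * besselInt ((1 - b) / 2 + 1) t + q * besselInt ((1 - b) / 2) t) t =
      p * besselInt ((1 - b) / 2 + 1) t + (q - p) * besselInt ((1 - b) / 2) t := by
  obtain ⟨a, rfl⟩ : ∃ a, b = 1 - 2 * a := ⟨(1 - b) / 2, by ring⟩
  rw [show (1 - (1 - 2 * a)) / 2 = a by ring]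
  have hd : ∀ s ∈ Ioi (0 : ℝ), deriv (fun t => p * besselInt (a + 1) t + q * besselInt a t) s =
      p * (-(s / 2) * besselInt a s) + q * (-(s / 2) * besselInt (a - 1) s) := by
    intro s hs
    have h := hasDerivAt_besselInt (a + 1) (ne_of_gt hs)
    rw [add_sub_cancel_right] at h
    exact ((h.const_mul p).add ((hasDerivAt_besselInt a (ne_of_gt hs)).const_mul q)).deriv
  have hdd := (EqOn.eventuallyEq_of_mem hd (Ioi_mem_nhds ht)).deriv_eq.trans
    (((hasDerivAt_neg_half_mul_besselInt a ht.ne').const_mul p).add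
      ((hasDerivAt_neg_half_mul_besselInt (a - 1) ht.ne').const_mul q)).deriv
  rw [Dbt, hdd, hd t ht, sub_add_cancel]
  field_simp
  ring

/-- There exists `φ : [0,∞) → ℝ`, twice continuously differentiable on `[0,∞)` and smooth
on `(0,∞)`, with `φ(0) = 1`, `φ'(0) = 0`, solving
`Δ_{b,t}(Δ_{b,t}φ) − 2 Δ_{b,t}φ + φ = 0` on `(0,∞)`, and with
`∫₀^∞ t^b [(Δ_{b,t}φ − φ)² + |φ'|² + |φ|²] dt < ∞`. -/
theorem stmt6 (b : ℝ) (hb1 : -1 < b) (hb2 : b < 1) :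
    ∃ φ : ℝ → ℝ,
      ContDiffOn ℝ 2 φ (Set.Ici 0) ∧
      ContDiffOn ℝ (⊤ : ℕ∞) φ (Set.Ioi 0) ∧
      φ 0 = 1 ∧
      derivWithin φ (Set.Ici 0) 0 = 0 ∧
      (∀ t : ℝ, 0 < t → Dbt b (Dbt b φ) t - 2 * Dbt b φ t + φ t = 0) ∧
      IntegrableOn
        (fun t : ℝ => t ^ b * ((Dbt b φ t - φ t) ^ 2 + (deriv φ t) ^ 2 + (φ t) ^ 2))
        (Set.Ioi 0) := by
  set a := (1 - b) / 2 with ha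
  have ha0 : 0 < a := by linarith
  have hΓ : Real.Gamma (a + 1) ≠ 0 := (Real.Gamma_pos_of_pos (by linarith)).ne'
  set k := (Real.Gamma (a + 1))⁻¹ with hk
  have hder (t : ℝ) : HasDerivAt (fun t => k * besselInt (a + 1) t)
      (k * (-(t / 2) * besselInt a t)) t := by
    simpa only [add_sub_cancel_right] using
      (hasDerivAt_besselInt_of_one_lt (a := a + 1) (by linarith) t).const_mul k
  have hD1 : EqOn (Dbt b fun t => k * besselInt (a + 1) t)
      (fun t => k * besselInt (a + 1) t + -k * besselInt a t) (Ioi 0) := fun t ht => by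
    simpa using Dbt_besselInt b k 0 ht
  refine ⟨fun t => k * besselInt (a + 1) t,
    (contDiff_const.mul (contDiff_two_besselInt (by linarith))).contDiffOn,
    contDiffOn_const.mul (contDiffOn_infty.2 fun n => contDiffOn_besselInt n (a + 1)), ?_, ?_,
    fun t ht => ?_, ?_⟩
  · simp only [besselInt_zero (show 0 < a + 1 by linarith), hk, inv_mul_cancel₀ hΓ]
  · rw [(hder 0).hasDerivWithinAt.derivWithin (uniqueDiffOn_Ici 0 0 self_mem_Ici)]
    simp
  · rw [Dbt_congr b hD1 ht, hD1 ht, Dbt_besselInt b k (-k) ht]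
    ring
  · have h1 := (integrableOn_rpow_mul_besselInt_sq ha0 hb1).const_mul (k ^ 2)
    have h2 := (integrableOn_rpow_mul_besselInt_sq ha0 (p := b + 2) (by linarith)).const_mul
      (k ^ 2 / 4)
    have h3 := (integrableOn_rpow_mul_besselInt_sq (a := a + 1) (by linarith) hb1).const_mul (k ^ 2)
    refine IntegrableOn.congr_fun ((h1.add h2).add h3) (fun t (ht : 0 < t) => ?_) measurableSet_Ioi
    simp only [Pi.add_apply]
    rw [hD1 ht, (hder t).deriv, Real.rpow_add ht, Real.rpow_two]
    ring

end
end

section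
/- Let ζ : (0,∞) → ℝ be twice continuously differentiable, solve ζ''(t) + (b/t) ζ'(t) = ζ(t) for all t > 0, and satisfy ∫₀^∞ t^b ζ(t)² dt < ∞. Then for all 0 < s < t one has |t^b ζ'(t) − s^b ζ'(s)| ≤ (b+1)^{−1/2} (∫₀^∞ τ^b ζ(τ)² dτ)^{1/2} (t^{b+1} − s^{b+1})^{1/2}. -/
open MeasureTheory Set

/-- Cauchy–Schwarz inequality for the weighted measure `w dx` on a compact interval. -/
theorem sq_intervalIntegral_mul_le {w f : ℝ → ℝ} {s t : ℝ} (hst : s ≤ t)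
    (hw : ContinuousOn w (Icc s t)) (hf : ContinuousOn f (Icc s t))
    (hw0 : ∀ x ∈ Icc s t, 0 ≤ w x) :
    (∫ x in s..t, w x * f x) ^ 2 ≤ (∫ x in s..t, w x) * ∫ x in s..t, w x * f x ^ 2 := by
  have hiw : IntervalIntegrable w volume s t := hw.intervalIntegrable_of_Icc hst
  have hiwf : IntervalIntegrable (fun x => w x * f x) volume s t :=
    (hw.mul hf).intervalIntegrable_of_Icc hst
  have hiwf2 : IntervalIntegrable (fun x => w x * f x ^ 2) volume s t :=
    (hw.mul (hf.pow 2)).intervalIntegrable_of_Icc hst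
  have hquad : ∀ c : ℝ, 0 ≤ (∫ x in s..t, w x) * (c * c)
      + (2 * ∫ x in s..t, w x * f x) * c + ∫ x in s..t, w x * f x ^ 2 := by
    intro c
    have h : ∫ x in s..t, w x * (c + f x) ^ 2 = (∫ x in s..t, w x) * (c * c)
        + (2 * ∫ x in s..t, w x * f x) * c + ∫ x in s..t, w x * f x ^ 2 := by
      calc ∫ x in s..t, w x * (c + f x) ^ 2
          = ∫ x in s..t, ((c * c) * w x + (2 * c) * (w x * f x)) + w x * f x ^ 2 := by
            congr 1
            funext x
            ring
        _ = _ := by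
            rw [intervalIntegral.integral_add ((hiw.const_mul _).add (hiwf.const_mul _)) hiwf2,
              intervalIntegral.integral_add (hiw.const_mul _) (hiwf.const_mul _),
              intervalIntegral.integral_const_mul, intervalIntegral.integral_const_mul]
            ring
    rw [← h]
    exact intervalIntegral.integral_nonneg hst fun x hx => mul_nonneg (hw0 x hx) (sq_nonneg _)
  have hdisc := discrim_le_zero hquad
  rw [discrim] at hdisc
  linarith

/-- If `ζ : (0,∞) → ℝ` is twice continuously differentiable, solves
`ζ'' + (b/t) ζ' = ζ` on `(0,∞)` and `∫₀^∞ t^b ζ² dt < ∞`, then for all `0 < s < t`,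
`|t^b ζ'(t) − s^b ζ'(s)| ≤ (b+1)^{−1/2} (∫₀^∞ τ^b ζ(τ)² dτ)^{1/2} (t^{b+1} − s^{b+1})^{1/2}`. -/
theorem stmt10 (b : ℝ) (hb1 : -1 < b) (hb2 : b < 1)
    (ζ : ℝ → ℝ) (hreg : ContDiffOn ℝ 2 ζ (Set.Ioi 0))
    (hode : ∀ t : ℝ, 0 < t → deriv (deriv ζ) t + (b / t) * deriv ζ t = ζ t)
    (hint : IntegrableOn (fun t : ℝ => t ^ b * (ζ t) ^ 2) (Set.Ioi 0)) :
    ∀ s t : ℝ, 0 < s → s < t →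
      |t ^ b * deriv ζ t - s ^ b * deriv ζ s|
        ≤ (b + 1) ^ (-(1 : ℝ) / 2)
            * (∫ τ in Set.Ioi (0 : ℝ), τ ^ b * (ζ τ) ^ 2) ^ ((1 : ℝ) / 2)
            * (t ^ (b + 1) - s ^ (b + 1)) ^ ((1 : ℝ) / 2) := by
  intro s t hs hst
  have hb : 0 < b + 1 := by linarith
  have ht : 0 < t := hs.trans hst
  have hpos : ∀ x ∈ Icc s t, 0 < x := fun x hx => hs.trans_le hx.1
  have hw : ContinuousOn (fun x : ℝ => x ^ b) (Icc s t) :=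
    continuousOn_id.rpow_const fun x hx => Or.inl (hpos x hx).ne'
  have hζ : ContinuousOn ζ (Icc s t) := hreg.continuousOn.mono hpos
  have hderiv : ∀ x ∈ uIcc s t,
      HasDerivAt (fun x => x ^ b * deriv ζ x) (x ^ b * ζ x) x := by
    intro x hx
    rw [uIcc_of_le hst.le] at hx
    have hx0 := hpos x hx
    have hd : DifferentiableAt ℝ (deriv ζ) x :=
      (((hreg.deriv_of_isOpen (m := 1) isOpen_Ioi (by norm_num)).differentiableOn
        (by norm_num)) x hx0).differentiableAt (Ioi_mem_nhds hx0)
    refine ((Real.hasDerivAt_rpow_const (p := b) (Or.inl hx0.ne')).mul hd.hasDerivAt).congr_deriv ?_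
    rw [← hode x hx0, Real.rpow_sub_one hx0.ne']
    ring
  have hD : ∫ x in s..t, x ^ b * ζ x = t ^ b * deriv ζ t - s ^ b * deriv ζ s :=
    intervalIntegral.integral_eq_sub_of_hasDerivAt hderiv
      ((hw.mul hζ).intervalIntegrable_of_Icc hst.le)
  have hA : ∫ x in s..t, x ^ b = (t ^ (b + 1) - s ^ (b + 1)) / (b + 1) :=
    integral_rpow (Or.inl hb1)
  have hC : ∫ x in s..t, x ^ b * ζ x ^ 2 ≤ ∫ τ in Ioi (0 : ℝ), τ ^ b * ζ τ ^ 2 := by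
    rw [intervalIntegral.integral_of_le hst.le]
    refine setIntegral_mono_set hint ?_
      (Ioc_subset_Ioi_self.trans (Ioi_subset_Ioi hs.le)).eventuallyLE
    filter_upwards [ae_restrict_mem measurableSet_Ioi] with x hx
    exact mul_nonneg (Real.rpow_nonneg (le_of_lt hx) _) (sq_nonneg _)
  have hI : 0 ≤ ∫ τ in Ioi (0 : ℝ), τ ^ b * ζ τ ^ 2 :=
    setIntegral_nonneg measurableSet_Ioi fun x hx =>
      mul_nonneg (Real.rpow_nonneg (le_of_lt hx) _) (sq_nonneg _)
  have hpow : 0 ≤ t ^ (b + 1) - s ^ (b + 1) :=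
    sub_nonneg.2 (Real.rpow_le_rpow hs.le hst.le hb.le)
  have hCS := sq_intervalIntegral_mul_le hst.le hw hζ
    fun x hx => Real.rpow_nonneg (hpos x hx).le b
  rw [hD, hA] at hCS
  have hle := hCS.trans (mul_le_mul_of_nonneg_left hC (div_nonneg hpow hb.le))
  refine (Real.abs_le_sqrt hle).trans_eq ?_
  rw [Real.sqrt_eq_rpow, Real.mul_rpow (div_nonneg hpow hb.le) hI, Real.div_rpow hpow hb.le,
    neg_div, Real.rpow_neg hb.le]
  ring
end
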